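/- Fix an integer k ≥ 2, a real 0 < ε < 1/2 and a real K > 0, and set β = ε/(10k) and η = εβ/(10⁵k²). There exists N = N(k,ε,K) such that for every n ≥ N the following holds. Let G be a finite simple graph on vertex set V with |V| = n, hom(G) < n/(k-1+ε) and f(G) < k, and let A ⊆ V satisfy |A| > βn/(10⁴k) and δ(x,y) < K for all x,y ∈ A. Let r be the unique nonnegative integer with r·n/(k-1+ε) < |A| - ηn ≤ (r+1)·n/(k-1+ε). Then there is a subset B ⊆ A with |B| > ηn/(2k²) such that either (i) every x ∈ B has degree between r and k-2 in the induced subgraph G[A], and every pair of distinct vertices of B is A-independent in G, or (ii) every x ∈ B has degree between r and k-2 in the induced subgraph of the complement of G on A, and every pair of distinct vertices of B is A-independent in the complement of G. -/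

import Mathlib

open Finset
open scoped Classical

/-- The number of distinct vertex degrees in the subgraph of `G` induced by `s`. -/
noncomputable def distinctDegrees {V : Type*} (G : SimpleGraph V) (s : Finset V) : ℕ :=
  (s.image fun x => (s.filter fun y => G.Adj x y).card).card

/-- `f(G)`: the largest number of distinct degrees in an induced subgraph of `G`. -/
noncomputable def fNumber {V : Type*} [Fintype V] (G : SimpleGraph V) : ℕ :=
  sSup {m : ℕ | ∃ s : Finset V, distinctDegrees G s = m}

/-- `hom(G)`: the size of the largest clique or independent set of `G`. -/
noncomputable def homNumber {V : Type*} (G : SimpleGraph V) : ℕ :=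
  sSup {n : ℕ | ∃ s : Finset V, (G.IsClique ↑s ∨ Gᶜ.IsClique ↑s) ∧ s.card = n}

/-- The neighbourhood-distance `δ(x,y) = |(Γ(x)\{y}) △ (Γ(y)\{x})|`. -/
noncomputable def nbhdDist {V : Type*} [Fintype V] (G : SimpleGraph V) (x y : V) : ℕ :=
  (symmDiff ((G.neighborFinset x).erase y) ((G.neighborFinset y).erase x)).card

/-- Greedy selection: if every element of `C` is `R`-related to at most `m` elements of `C`, then
`C` has an `R`-free subset of size at least `C.card / m`. -/
lemma exists_subset_pairwise_not_rel {α : Type*} (R : α → α → Prop) (hrefl : ∀ x, R x x)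
    (hsymm : ∀ x y, R x y → R y x) (C : Finset α) (m : ℕ)
    (hm : ∀ x ∈ C, (C.filter fun y => R x y).card ≤ m) :
    ∃ B ⊆ C, (∀ x ∈ B, ∀ y ∈ B, x ≠ y → ¬ R x y) ∧ C.card ≤ m * B.card := by
  obtain ⟨B, hB, hmax⟩ := Finset.exists_max_image
    (C.powerset.filter fun B => ∀ x ∈ B, ∀ y ∈ B, x ≠ y → ¬ R x y) Finset.card
    ⟨∅, by simp⟩
  simp only [mem_filter, mem_powerset] at hB hmax
  refine ⟨B, hB.1, hB.2, ?_⟩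
  have hcover : C ⊆ B.biUnion fun x => C.filter fun y => R x y := by
    intro y hy
    by_contra hcon
    simp only [mem_biUnion, mem_filter, not_exists, not_and] at hcon
    have hyB : y ∉ B := fun h => hcon y h hy (hrefl y)
    have := hmax (insert y B) ⟨insert_subset hy hB.1, by
      intro a ha b hb hab hR
      rw [mem_insert] at ha hb
      rcases ha with rfl | ha <;> rcases hb with rfl | hb
      · exact hab rfl
      · exact hcon b hb hy (hsymm _ _ hR)
      · exact hcon a ha hy hR
      · exact hB.2 a ha b hb hab hR⟩
    rw [card_insert_of_notMem hyB] at this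
    omega
  calc C.card ≤ _ := card_le_card hcover
    _ ≤ B.card * m := card_biUnion_le_card_mul _ _ _ fun x hx => hm x (hB.1 hx)
    _ = m * B.card := mul_comm _ _

lemma distinctDegrees_le_fNumber {V : Type*} [Fintype V] (G : SimpleGraph V) (s : Finset V) :
    distinctDegrees G s ≤ fNumber G := by
  refine le_csSup ⟨Fintype.card V, ?_⟩ ⟨s, rfl⟩
  rintro _ ⟨t, rfl⟩
  exact card_image_le.trans (card_le_univ t)

lemma card_le_homNumber {V : Type*} [Fintype V] (G : SimpleGraph V) {s : Finset V}
    (hs : G.IsClique ↑s ∨ Gᶜ.IsClique ↑s) : s.card ≤ homNumber G := by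
  refine le_csSup ⟨Fintype.card V, ?_⟩ ⟨s, hs, rfl⟩
  rintro _ ⟨t, _, rfl⟩
  exact card_le_univ t

lemma nbhdDist_compl_le {V : Type*} [Fintype V] (G : SimpleGraph V) (x y : V) :
    nbhdDist Gᶜ x y ≤ nbhdDist G x y := by
  refine card_le_card fun z hz => ?_
  simp only [mem_symmDiff, mem_erase, SimpleGraph.mem_neighborFinset,
    SimpleGraph.compl_adj] at hz ⊢
  have := G.irrefl (v := x)
  have := G.irrefl (v := y)
  grind

section

variable {V : Type*} [DecidableEq V]

/-- The closed neighbourhood of `x` within `A`. -/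
abbrev closedNbhd (G : SimpleGraph V) [DecidableRel G.Adj] (A : Finset V) (x : V) : Finset V :=
  insert x (A.filter fun z => G.Adj x z)

lemma mem_closedNbhd_comm (G : SimpleGraph V) [DecidableRel G.Adj] {A : Finset V} {x z : V}
    (hx : x ∈ A) (h : z ∈ closedNbhd G A x) : x ∈ closedNbhd G A z := by
  simp only [closedNbhd, mem_insert, mem_filter] at h ⊢
  rcases h with rfl | h
  · exact Or.inl rfl
  · exact Or.inr ⟨hx, h.2.symm⟩

lemma closedNbhd_subset (G : SimpleGraph V) [DecidableRel G.Adj] {A : Finset V} {x : V}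
    (hx : x ∈ A) : closedNbhd G A x ⊆ A :=
  insert_subset hx (filter_subset _ _)

lemma card_closedNbhd_le (G : SimpleGraph V) [DecidableRel G.Adj] {A : Finset V} {x : V} {d : ℕ}
    (h : (A.filter fun y => G.Adj x y).card ≤ d) : (closedNbhd G A x).card ≤ d + 1 :=
  (card_insert_le _ _).trans (by omega)

/-- A set of vertices, each of degree at most `d` in `A` and having only neighbours of degree at
most `d` in `A`, contains many pairwise `A`-independent vertices. -/
lemma exists_independent_subset (G : SimpleGraph V) [DecidableRel G.Adj] {A C : Finset V}
    (hCA : C ⊆ A) (d : ℕ)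
    (hd : ∀ x ∈ C, ∀ z ∈ closedNbhd G A x, (A.filter fun y => G.Adj z y).card ≤ d) :
    ∃ B ⊆ C, (∀ x ∈ B, ∀ y ∈ B, x ≠ y → Disjoint (closedNbhd G A x) (closedNbhd G A y)) ∧
      C.card ≤ (d + 1) * (d + 1) * B.card := by
  obtain ⟨B, hBC, hB, hcard⟩ := exists_subset_pairwise_not_rel
    (fun x y => ¬ Disjoint (closedNbhd G A x) (closedNbhd G A y)) (by simp)
    (fun x y h h' => h h'.symm) C ((d + 1) * (d + 1)) (by
      intro x hx
      calc _ ≤ ((closedNbhd G A x).biUnion fun z => closedNbhd G A z).card := by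
            refine card_le_card fun y hy => ?_
            simp only [mem_filter] at hy
            obtain ⟨hyC, hy⟩ := hy
            obtain ⟨z, hzx, hzy⟩ := not_disjoint_iff.1 hy
            exact mem_biUnion.2 ⟨z, hzx, mem_closedNbhd_comm G (hCA hyC) hzy⟩
        _ ≤ (closedNbhd G A x).card * (d + 1) :=
          card_biUnion_le_card_mul _ _ _ fun z hz => card_closedNbhd_le G (hd x hx z hz)
        _ ≤ _ := Nat.mul_le_mul_right _
          (card_closedNbhd_le G (hd x hx x (mem_insert_self _ _))))
  exact ⟨B, hBC, fun x hx y hy hxy => not_not.1 (hB x hx y hy hxy), hcard⟩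

/-- Pairwise `A`-independent vertices of degree at least `k - 1` in `A`, at least `k` of them,
yield an induced subgraph with at least `k` distinct degrees. -/
lemma exists_le_distinctDegrees (G : SimpleGraph V) [DecidableRel G.Adj] {A B : Finset V} {k : ℕ}
    (hBA : B ⊆ A) (hdeg : ∀ x ∈ B, k - 1 ≤ (A.filter fun y => G.Adj x y).card)
    (hind : ∀ x ∈ B, ∀ y ∈ B, x ≠ y → Disjoint (closedNbhd G A x) (closedNbhd G A y))
    (hk : k ≤ B.card) : ∃ s : Finset V, k ≤ distinctDegrees G s := by
  let x : Fin k → V := fun i => (B.equivFin.symm (Fin.castLE hk i) : V)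
  have hxB : ∀ i, x i ∈ B := fun i => (B.equivFin.symm (Fin.castLE hk i)).2
  have hxinj : Function.Injective x := fun i j h =>
    Fin.castLE_injective hk (B.equivFin.symm.injective (Subtype.ext h))
  have hT : ∀ i : Fin k, ∃ T ⊆ A.filter fun y => G.Adj (x i) y, T.card = i := fun i =>
    exists_subset_card_eq (le_trans (by omega) (hdeg _ (hxB i)))
  choose T hTsub hTcard using hT
  let s : Finset V := univ.biUnion fun i => insert (x i) (T i)
  have hs : ∀ i, (s.filter fun y => G.Adj (x i) y) = T i := by
    intro i
    ext y
    simp only [s, mem_filter, mem_biUnion, mem_univ, true_and]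
    constructor
    · rintro ⟨⟨j, hj⟩, hadj⟩
      have hyj : y ∈ closedNbhd G A (x j) := insert_subset_insert _ (hTsub j) hj
      by_cases hij : i = j
      · subst hij
        rcases mem_insert.1 hj with rfl | hj
        · exact (G.irrefl hadj).elim
        · exact hj
      · have hyA := closedNbhd_subset G (hBA (hxB j)) hyj
        exact (disjoint_left.1 (hind _ (hxB i) _ (hxB j) (hxinj.ne hij))
          (mem_insert_of_mem (mem_filter.2 ⟨hyA, hadj⟩)) hyj).elim
    · intro hy
      exact ⟨⟨i, mem_insert_of_mem hy⟩, (mem_filter.1 (hTsub i hy)).2⟩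
  refine ⟨s, ?_⟩
  have hsub : range k ⊆ s.image fun x => (s.filter fun y => G.Adj x y).card := by
    intro i hi
    refine mem_image.2 ⟨x ⟨i, mem_range.1 hi⟩, ?_, ?_⟩
    · exact mem_biUnion.2 ⟨_, mem_univ _, mem_insert_self _ _⟩
    · rw [hs, hTcard]
  have hcard := card_le_card hsub
  rw [card_range] at hcard
  unfold distinctDegrees
  convert hcard

/-- In a set of bounded degree, few distinct degrees and small independent sets force many
pairwise independent vertices of middling degree. -/
lemma exists_independent_middling (G : SimpleGraph V) [DecidableRel G.Adj] (A : Finset V)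
    {k D r h : ℕ} (hk : 2 ≤ k) (hD : ∀ x ∈ A, (A.filter fun y => G.Adj x y).card ≤ D)
    (hf : ∀ s : Finset V, distinctDegrees G s < k)
    (hI : ∀ s : Finset V, Gᶜ.IsClique ↑s → s.card ≤ h) :
    ∃ B ⊆ A, A.card ≤ k ^ 2 * B.card + r * h + k * (D + 1) ^ 3 ∧
      (∀ x ∈ B, r ≤ (A.filter fun y => G.Adj x y).card ∧
        (A.filter fun y => G.Adj x y).card ≤ k - 2) ∧
      (∀ x ∈ B, ∀ y ∈ B, x ≠ y → Disjoint (closedNbhd G A x) (closedNbhd G A y)) := by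
  set low := A.filter fun x => (A.filter fun y => G.Adj x y).card < r with hlow
  set high := A.filter fun x => k - 1 ≤ (A.filter fun y => G.Adj x y).card with hhigh
  set near := high.biUnion fun x => closedNbhd G A x with hnear
  have hlow_card : low.card ≤ r * h := by
    obtain ⟨I, hIlow, hI', hcard⟩ := exists_subset_pairwise_not_rel
      (fun x y => x = y ∨ G.Adj x y) (by simp)
      (fun x y hxy => hxy.imp Eq.symm SimpleGraph.Adj.symm) low r (by
        intro x hx
        have hxr := (mem_filter.1 hx).2
        refine le_trans (card_le_card (t := closedNbhd G A x) fun y hy => ?_)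
          ((card_closedNbhd_le G (d := r - 1) (by omega)).trans (by omega))
        simp only [mem_filter (s := low)] at hy
        obtain ⟨hy, rfl | hxy⟩ := hy
        · exact mem_insert_self _ _
        · exact mem_insert_of_mem (mem_filter.2 ⟨(mem_filter.1 hy).1, hxy⟩))
    refine hcard.trans (Nat.mul_le_mul_left _ (hI I ?_))
    intro a ha b hb hab
    exact (SimpleGraph.compl_adj _ _ _).2 ⟨hab, fun hadj => hI' a ha b hb hab (Or.inr hadj)⟩
  have hhigh_card : high.card ≤ (D + 1) * (D + 1) * k := by
    obtain ⟨B, hB, hind, hcard⟩ := exists_independent_subset G (A := A) (C := high)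
      (filter_subset _ _) D
      (fun x hx z hz => hD z (closedNbhd_subset G (mem_filter.1 hx).1 hz))
    refine hcard.trans (Nat.mul_le_mul_left _ ?_)
    by_contra hcon
    obtain ⟨s, hs⟩ := exists_le_distinctDegrees G (hB.trans (filter_subset _ _))
      (fun x hx => (mem_filter.1 (hB hx)).2) hind (by omega)
    exact (hf s).not_ge hs
  have hnear_card : near.card ≤ k * (D + 1) ^ 3 :=
    calc near.card ≤ high.card * (D + 1) := card_biUnion_le_card_mul _ _ _ fun x hx =>
          card_closedNbhd_le G (hD x (mem_filter.1 hx).1)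
      _ ≤ (D + 1) * (D + 1) * k * (D + 1) := Nat.mul_le_mul_right _ hhigh_card
      _ = _ := by ring
  have hmid : ∀ x ∈ A \ (low ∪ near), ∀ z ∈ closedNbhd G A x,
      (A.filter fun y => G.Adj z y).card ≤ k - 2 := by
    intro x hx z hz
    obtain ⟨hxA, hx⟩ := mem_sdiff.1 hx
    by_contra hcon
    have hzh : z ∈ high :=
      mem_filter.2 ⟨closedNbhd_subset G hxA hz, by omega⟩
    exact hx (mem_union_right _ (mem_biUnion.2 ⟨z, hzh, mem_closedNbhd_comm G hxA hz⟩))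
  obtain ⟨B, hB, hind, hcard⟩ := exists_independent_subset G (A := A) sdiff_subset (k - 2) hmid
  refine ⟨B, hB.trans sdiff_subset, ?_, ?_, hind⟩
  · have h1 : A.card ≤ (A \ (low ∪ near)).card + (low.card + near.card) :=
      (card_le_card_sdiff_add_card (s := A) (t := low ∪ near)).trans
        (Nat.add_le_add_left (card_union_le _ _) _)
    have h2 : (k - 2 + 1) * (k - 2 + 1) * B.card ≤ k ^ 2 * B.card := by
      rw [pow_two]
      exact Nat.mul_le_mul_right _ (Nat.mul_le_mul (by omega) (by omega))
    omega
  · intro x hx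
    refine ⟨?_, hmid x (hB hx) x (mem_insert_self _ _)⟩
    obtain ⟨hxA, hx⟩ := mem_sdiff.1 (hB hx)
    by_contra hcon
    exact hx (mem_union_left _ (mem_filter.2 ⟨hxA, by omega⟩))

lemma card_filter_adj_add_card_filter_compl_adj (G : SimpleGraph V) [DecidableRel G.Adj]
    [DecidableRel Gᶜ.Adj] {s : Finset V} {x : V} (hx : x ∈ s) :
    (s.filter fun y => G.Adj x y).card + (s.filter fun y => Gᶜ.Adj x y).card + 1 = s.card := by
  have h1 : (s.filter fun y => ¬ G.Adj x y) = insert x (s.filter fun y => Gᶜ.Adj x y) := by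
    ext y
    simp only [mem_filter, mem_insert, SimpleGraph.compl_adj]
    constructor
    · rintro ⟨hy, hxy⟩
      by_cases h : y = x
      · exact Or.inl h
      · exact Or.inr ⟨hy, Ne.symm h, hxy⟩
    · rintro (rfl | ⟨hy, _, hxy⟩)
      · exact ⟨hx, G.irrefl⟩
      · exact ⟨hy, hxy⟩
  have h2 := card_filter_add_card_filter_not (s := s) (fun y => G.Adj x y)
  rw [h1, card_insert_of_notMem (by simp)] at h2
  omega

lemma distinctDegrees_compl_le (G : SimpleGraph V) (s : Finset V) :
    distinctDegrees Gᶜ s ≤ distinctDegrees G s := by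
  have h : (s.image fun x => (s.filter fun y => Gᶜ.Adj x y).card) ⊆
      (s.image fun x => (s.filter fun y => G.Adj x y).card).image fun d => s.card - 1 - d := by
    intro d hd
    obtain ⟨x, hx, rfl⟩ := mem_image.1 hd
    have := card_filter_adj_add_card_filter_compl_adj G hx
    exact mem_image.2 ⟨_, mem_image_of_mem _ hx, by omega⟩
  have := (card_le_card h).trans card_image_le
  unfold distinctDegrees
  convert this using 1 <;> congr!

lemma card_filter_adj_not_adj_le_nbhdDist [Fintype V] (G : SimpleGraph V) [DecidableRel G.Adj]
    (A : Finset V) (x y : V) :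
    (A.filter fun z => G.Adj x z ∧ ¬ G.Adj y z ∧ y ≠ z).card ≤ nbhdDist G x y := by
  refine card_le_card fun z hz => ?_
  obtain ⟨-, h1, h2, h3⟩ := mem_filter.1 hz
  simp only [mem_symmDiff, mem_erase, SimpleGraph.mem_neighborFinset]
  exact Or.inl ⟨⟨h3.symm, h1⟩, fun h => h2 h.2⟩

lemma card_filter_adj_le_add_nbhdDist [Fintype V] (G : SimpleGraph V) [DecidableRel G.Adj]
    (A : Finset V) (x y : V) :
    (A.filter fun z => G.Adj x z).card ≤
      (A.filter fun z => G.Adj y z).card + 1 + nbhdDist G x y := by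
  have hsub : (A.filter fun z => G.Adj x z) ⊆
      closedNbhd G A y ∪ A.filter fun z => G.Adj x z ∧ ¬ G.Adj y z ∧ y ≠ z := by
    intro z hz
    simp only [closedNbhd, mem_union, mem_insert, mem_filter] at hz ⊢
    grind
  have h1 := (card_le_card hsub).trans (card_union_le _ _)
  have h2 := card_filter_adj_not_adj_le_nbhdDist G A x y
  have h3 := card_closedNbhd_le G (A := A) (x := y) le_rfl
  omega

/-- A set of vertices that are pairwise close in neighbourhood-distance contains a vertex whose
degree and codegree within the set have small product. -/
lemma exists_card_adj_mul_card_compl_adj_le [Fintype V] (G : SimpleGraph V) [DecidableRel G.Adj]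
    [DecidableRel Gᶜ.Adj] {A : Finset V} {M : ℕ} (hA : A.Nonempty)
    (hM : ∀ x ∈ A, ∀ y ∈ A, nbhdDist G x y ≤ M) :
    ∃ z ∈ A, (A.filter fun y => G.Adj z y).card * (A.filter fun y => Gᶜ.Adj z y).card ≤
      A.card * M := by
  apply exists_le_of_sum_le hA
  calc ∑ z ∈ A, (A.filter fun y => G.Adj z y).card * (A.filter fun y => Gᶜ.Adj z y).card
      = ∑ z ∈ A, ∑ p ∈ A ×ˢ A, if G.Adj p.1 z ∧ ¬ G.Adj p.2 z ∧ p.2 ≠ z then 1 else 0 := by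
        refine sum_congr rfl fun z _ => ?_
        rw [← card_product, ← card_filter]
        congr 1
        ext ⟨x, y⟩
        simp only [mem_product, mem_filter, SimpleGraph.compl_adj, G.adj_comm z]
        grind
    _ = ∑ p ∈ A ×ˢ A, (A.filter fun z => G.Adj p.1 z ∧ ¬ G.Adj p.2 z ∧ p.2 ≠ z).card := by
        rw [sum_comm]
        exact sum_congr rfl fun p _ => (card_filter _ _).symm
    _ ≤ ∑ p ∈ A ×ˢ A, M := sum_le_sum fun p hp =>
        (card_filter_adj_not_adj_le_nbhdDist G A p.1 p.2).trans
          (hM _ (mem_product.1 hp).1 _ (mem_product.1 hp).2)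
    _ = ∑ z ∈ A, A.card * M := by
        simp [card_product, mul_assoc]

/-- A set of vertices that are pairwise close in neighbourhood-distance has bounded degree in the
graph or in its complement. -/
lemma card_adj_le_or_card_compl_adj_le [Fintype V] (G : SimpleGraph V) [DecidableRel G.Adj]
    [DecidableRel Gᶜ.Adj] {A : Finset V} {M : ℕ} (hA : 2 ≤ A.card)
    (hM : ∀ x ∈ A, ∀ y ∈ A, nbhdDist G x y ≤ M) :
    (∀ x ∈ A, (A.filter fun y => G.Adj x y).card ≤ 5 * M + 1) ∨
      (∀ x ∈ A, (A.filter fun y => Gᶜ.Adj x y).card ≤ 5 * M + 1) := by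
  obtain ⟨z, hz, hprod⟩ :=
    exists_card_adj_mul_card_compl_adj_le G (card_pos.1 (by omega : 0 < A.card)) hM
  have hsum := card_filter_adj_add_card_filter_compl_adj G hz
  have key : ∀ a b : ℕ, a + b + 1 = A.card → a * b ≤ A.card * M → a ≤ b → a ≤ 4 * M := by
    intro a b h1 h2 h3
    by_contra hcon
    have hb : A.card ≤ 4 * b := by omega
    nlinarith [Nat.mul_le_mul_right M hb, Nat.mul_le_mul_right b (Nat.lt_of_not_ge hcon)]
  rcases le_total (A.filter fun y => G.Adj z y).card (A.filter fun y => Gᶜ.Adj z y).card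
    with hle | hle
  · left
    intro x hx
    have h1 := key _ _ hsum hprod hle
    have h2 := card_filter_adj_le_add_nbhdDist G A x z
    have h3 := hM x hx z hz
    omega
  · right
    intro x hx
    have h1 := key _ _ (by omega) (by rwa [mul_comm]) hle
    have h2 := card_filter_adj_le_add_nbhdDist Gᶜ A x z
    have h3 := (nbhdDist_compl_le G x z).trans (hM x hx z hz)
    omega

end

/-- Claim on independent vertices of middling degree: with `β = ε/(10k)` and `η = εβ/(10⁵k²)`,
for all sufficiently large `n`, if `G` is an `n`-vertex graph with `hom(G) < n/(k-1+ε)` and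
`f(G) < k`, and `A` is a vertex set with `|A| > βn/(10⁴k)` whose internal
neighbourhood-distances are all less than `K`, and `r` is the unique nonnegative integer with
`rn/(k-1+ε) < |A| - ηn ≤ (r+1)n/(k-1+ε)`, then there is `B ⊆ A` with `|B| > ηn/(2k²)` such
that either every vertex of `B` has degree between `r` and `k-2` in `G[A]` and the vertices of
`B` are pairwise `A`-independent in `G`, or the same holds in the complement of `G`. -/
theorem stmt_13 (k : ℕ) (hk : 2 ≤ k) (ε K : ℝ) (hε₁ : 0 < ε) (hε₂ : ε < 1 / 2) (hK : 0 < K) :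
    let β : ℝ := ε / (10 * k)
    let η : ℝ := ε * β / (10 ^ 5 * (k : ℝ) ^ 2)
    ∃ N : ℕ, ∀ n : ℕ, N ≤ n → ∀ G : SimpleGraph (Fin n),
      (homNumber G : ℝ) < (n : ℝ) / ((k : ℝ) - 1 + ε) → fNumber G < k →
      ∀ A : Finset (Fin n),
        ((A.card : ℝ) > β * (n : ℝ) / (10 ^ 4 * (k : ℝ))) →
        (∀ x ∈ A, ∀ y ∈ A, (nbhdDist G x y : ℝ) < K) →
      ∀ r : ℕ,
        ((r : ℝ) * (n : ℝ) / ((k : ℝ) - 1 + ε) < (A.card : ℝ) - η * (n : ℝ)) →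
        ((A.card : ℝ) - η * (n : ℝ) ≤ ((r : ℝ) + 1) * (n : ℝ) / ((k : ℝ) - 1 + ε)) →
      ∃ B ⊆ A, ((B.card : ℝ) > η * (n : ℝ) / (2 * (k : ℝ) ^ 2)) ∧
        (((∀ x ∈ B, r ≤ (A.filter fun y => G.Adj x y).card ∧
              (A.filter fun y => G.Adj x y).card ≤ k - 2) ∧
            (∀ x ∈ B, ∀ y ∈ B, x ≠ y →
              Disjoint (insert x (A.filter fun z => G.Adj x z))
                (insert y (A.filter fun z => G.Adj y z)))) ∨
          ((∀ x ∈ B, r ≤ (A.filter fun y => Gᶜ.Adj x y).card ∧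
              (A.filter fun y => Gᶜ.Adj x y).card ≤ k - 2) ∧
            (∀ x ∈ B, ∀ y ∈ B, x ≠ y →
              Disjoint (insert x (A.filter fun z => Gᶜ.Adj x z))
                (insert y (A.filter fun z => Gᶜ.Adj y z))))) := by
  intro β η
  have hk0 : (2 : ℝ) ≤ k := by exact_mod_cast hk
  have hη : 0 < η := by positivity
  have hden : 0 < (k : ℝ) - 1 + ε := by linarith
  set M : ℕ := ⌈K⌉₊ with hMdef
  set L : ℕ := k * (5 * M + 1 + 1) ^ 3 with hLdef
  have hL : 2 ≤ L := hk.trans (Nat.le_mul_of_pos_right _ (by positivity))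
  have hL0 : (2 : ℝ) ≤ L := by exact_mod_cast hL
  refine ⟨⌈2 * L / η⌉₊, fun n hn G hhom hf A _ hAK r hr _ => ?_⟩
  have hn' : 2 * (L : ℝ) ≤ η * n := by
    have := (Nat.le_ceil _).trans (Nat.cast_le (α := ℝ).2 hn)
    rwa [div_le_iff₀ hη, mul_comm (n : ℝ)] at this
  have hAcard : 2 ≤ A.card := by
    have h0 : (0 : ℝ) ≤ r * n / ((k : ℝ) - 1 + ε) := by positivity
    have : (2 : ℝ) ≤ A.card := by linarith
    exact_mod_cast this
  have hM : ∀ x ∈ A, ∀ y ∈ A, nbhdDist G x y ≤ M := fun x hx y hy => by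
    have := (hAK x hx y hy).le.trans (Nat.le_ceil K)
    exact_mod_cast this
  have hB : ∀ B : Finset (Fin n), A.card ≤ k ^ 2 * B.card + r * homNumber G + L →
      (B.card : ℝ) > η * n / (2 * (k : ℝ) ^ 2) := by
    intro B h
    have h1 : (A.card : ℝ) ≤ k ^ 2 * B.card + r * homNumber G + L := by exact_mod_cast h
    have h2 : (r : ℝ) * homNumber G ≤ r * n / ((k : ℝ) - 1 + ε) := by
      rw [mul_div_assoc]
      exact mul_le_mul_of_nonneg_left hhom.le (Nat.cast_nonneg r)
    rw [gt_iff_lt, div_lt_iff₀ (by positivity)]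
    linarith
  have hdd : ∀ s, distinctDegrees G s < k := fun s => (distinctDegrees_le_fNumber G s).trans_lt hf
  rcases card_adj_le_or_card_compl_adj_le G hAcard hM with hD | hD
  · obtain ⟨B, hBA, hcard, hdeg, hind⟩ := exists_independent_middling G A (r := r) hk hD hdd
      (fun s hs => card_le_homNumber G (Or.inr hs))
    exact ⟨B, hBA, hB B hcard, Or.inl ⟨hdeg, hind⟩⟩
  · obtain ⟨B, hBA, hcard, hdeg, hind⟩ := exists_independent_middling Gᶜ A (r := r) hk hD
      (fun s => (distinctDegrees_compl_le G s).trans_lt (hdd s))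
      (fun s hs => card_le_homNumber G (Or.inl (by rwa [compl_compl] at hs)))
    exact ⟨B, hBA, hB B hcard, Or.inr ⟨hdeg, hind⟩⟩
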